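/- Let t be a positive integer, p prime, and V ⊆ F_p^n a subspace. Write V^⟨t⟩ = C₁ ⊕ ⋯ ⊕ C_m for the stabiliser decomposition with m = dim St(V^⟨t⟩), let I = {i : dim C_i ≥ 2}, S = ⋃_{i∈I} supp(C_i), and W = V|_S (the restriction of V to coordinates in S). Then for all 2 ≤ r ≤ t: dim V^⟨r⟩ ≥ dim V^⟨r−1⟩ + (1/2)·dim W. -/

import Mathlib

open Submodule

/-- The (Schur / coordinatewise) product of two subspaces of `Fin n → K`. -/
def schurMul {K : Type*} [CommRing K] {n : ℕ} (C D : Submodule K (Fin n → K)) :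
    Submodule K (Fin n → K) :=
  Submodule.span K {x | ∃ c ∈ C, ∃ d ∈ D, x = c * d}

/-- `schurPow C k` is the `(k+1)`-st Schur power `C^⟨k+1⟩`; so `schurPow C 0 = C^⟨1⟩ = C`. -/
def schurPow {K : Type*} [CommRing K] {n : ℕ} (C : Submodule K (Fin n → K)) :
    ℕ → Submodule K (Fin n → K)
  | 0 => C
  | k + 1 => schurMul (schurPow C k) C

/-- The stabiliser `St(E) = {x : x * E ⊆ E}` of a subspace, itself a subspace. -/
def stab {K : Type*} [CommRing K] {n : ℕ} (E : Submodule K (Fin n → K)) :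
    Submodule K (Fin n → K) where
  carrier := {x | ∀ e ∈ E, x * e ∈ E}
  add_mem' := fun {a b} ha hb e he => by simpa [add_mul] using E.add_mem (ha e he) (hb e he)
  zero_mem' := fun e he => by simp
  smul_mem' := fun c {x} hx e he => by simpa [smul_mul_assoc] using E.smul_mem c (hx e he)

/-- Support of a subspace of `Fin n → K`. -/
def suppS {K : Type*} [CommRing K] {n : ℕ} (C : Submodule K (Fin n → K)) : Set (Fin n) :=
  {i | ∃ v ∈ C, v i ≠ 0}

/-- Characteristic vector of a finite set. -/
def charVec (R : Type*) [Zero R] [One R] {n : ℕ} (A : Finset (Fin n)) : Fin n → R :=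
  fun i => if i ∈ A then 1 else 0

/-- `𝓕` is `k`-wise `ℓ`-divisible: every intersection of `k` (not necessarily distinct)
members of `𝓕` has cardinality divisible by `ℓ`. -/
def kWiseDiv (n k ℓ : ℕ) (𝓕 : Finset (Finset (Fin n))) : Prop :=
  ∀ A : Fin k → Finset (Fin n), (∀ i, A i ∈ 𝓕) → ℓ ∣ (Finset.univ.inf A).card

/-- Support of a set family. -/
def famSupp {n : ℕ} (ℱ : Set (Finset (Fin n))) : Set (Fin n) :=
  ⋃ B ∈ ℱ, (B : Set (Fin n))

/-- `A` is an atom of the family `ℱ`: a nonempty subset of the support such that every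
member of `ℱ` contains `A` or is disjoint from it, maximal with this property. -/
def IsAtomOf {n : ℕ} (ℱ : Set (Finset (Fin n))) (A : Finset (Fin n)) : Prop :=
  A.Nonempty ∧ (A : Set (Fin n)) ⊆ famSupp ℱ ∧ (∀ B ∈ ℱ, A ⊆ B ∨ Disjoint A B) ∧
    ∀ A' : Finset (Fin n), A ⊆ A' → (A' : Set (Fin n)) ⊆ famSupp ℱ →
      (∀ B ∈ ℱ, A' ⊆ B ∨ Disjoint A' B) → A' = A

/-- The family `ℱ^r` of all `r`-fold intersections of members of `ℱ`. -/
def interFam {n : ℕ} (ℱ : Set (Finset (Fin n))) (r : ℕ) : Set (Finset (Fin n)) :=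
  {S | ∃ f : Fin r → Finset (Fin n), (∀ i, f i ∈ ℱ) ∧ S = Finset.univ.inf f}

/-- The linear map sending `v` to its restriction (indicator) on a coordinate set `S`. -/
noncomputable def indicatorMapL {K : Type*} [CommRing K] {n : ℕ} (S : Set (Fin n)) :
    (Fin n → K) →ₗ[K] (Fin n → K) where
  toFun v := S.indicator v
  map_add' a b := by
    funext i; by_cases h : i ∈ S <;> simp [Set.indicator_apply, h]
  map_smul' c a := by
    funext i; by_cases h : i ∈ S <;> simp [Set.indicator_apply, h]

/-- Restriction (projection) of a subspace `V` to the coordinates in `S`. -/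
noncomputable def restrTo {K : Type*} [CommRing K] {n : ℕ} (S : Set (Fin n))
    (V : Submodule K (Fin n → K)) : Submodule K (Fin n → K) :=
  V.map (indicatorMapL S)


section kneserAux

variable {K : Type*} [Field K] {n : ℕ}

/-- generic elements of a subspace -/
theorem exists_generic {E : Type*} [AddCommGroup E] [Module K E] [Infinite K] {ι : Type*} [Finite ι]
    (V : Submodule K E) (N : ι → Submodule K E) (h : ∀ i, ¬ V ≤ N i) :
    ∃ v ∈ V, ∀ i, v ∉ N i := by
  by_contra hc
  push Not at hc
  have hcov : ⋃ i, (((N i).comap V.subtype : Subspace K V) : Set V) = Set.univ := by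
    ext ⟨v, hv⟩
    simpa using hc v hv
  obtain ⟨i, hi⟩ := Subspace.exists_eq_top_of_iUnion_eq_univ hcov
  apply h i
  intro v hv
  have : (⟨v, hv⟩ : V) ∈ (N i).comap V.subtype := by rw [hi]; trivial
  simpa using this

theorem mulLeft_inj {u : Fin n → K} (hu : ∀ i, u i ≠ 0) :
    Function.Injective (LinearMap.mulLeft K u) := by
  intro x y h
  funext i
  have := congrFun h i
  simpa [hu i] using this

theorem finrank_mapMul {u : Fin n → K} (hu : ∀ i, u i ≠ 0) (A : Submodule K (Fin n → K)) :
    Module.finrank K (A.map (LinearMap.mulLeft K u)) = Module.finrank K A :=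
  (LinearEquiv.finrank_eq (Submodule.equivMapOfInjective _ (mulLeft_inj hu) A)).symm

theorem exists_unit_avoid [Infinite K] {u : Fin n → K} (hu : ∀ i, u i ≠ 0) (b : Fin n → K) :
    ∃ c : K, ∀ i, (b + c • u) i ≠ 0 := by
  classical
  obtain ⟨c, hc⟩ := Infinite.exists_notMem_finset (Finset.univ.image fun i => - b i / u i)
  refine ⟨c, fun i h => hc ?_⟩
  simp only [Finset.mem_image, Finset.mem_univ, true_and]
  refine ⟨i, ?_⟩
  have h' : b i + c * u i = 0 := by simpa using h
  rw [div_eq_iff (hu i)]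
  linear_combination -h'

theorem kneser_local [Infinite K] (d : ℕ) : ∀ (A B : Submodule K (Fin n → K)),
    Module.finrank K A ≤ d → (1 : Fin n → K) ∈ A → (∃ u ∈ B, ∀ i, u i ≠ 0) →
    ∃ H U : Submodule K (Fin n → K), 1 ∈ H ∧ H * H ≤ H ∧ B ≤ U ∧ U ≤ A * B ∧ H * U ≤ U ∧
      Module.finrank K A + Module.finrank K B ≤ Module.finrank K U + Module.finrank K H := by
  induction d with
  | zero =>
    intro A B hd h1 hu
    have hA : A = ⊥ := Submodule.finrank_eq_zero.mp (by omega)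
    refine ⟨⊤, B, trivial, le_top, le_rfl, ?_, ?_, ?_⟩
    · intro b hb
      simpa using Submodule.mul_mem_mul h1 hb
    · rw [Submodule.mul_le]
      intro h _ b hb
      have : (1 : Fin n → K) = 0 := by simpa [hA] using h1
      have h2 : h * b = 0 := by rw [← mul_one (h * b), this, mul_zero]
      rw [h2]; exact B.zero_mem
    · rw [hA]; simp
  | succ d ih =>
    intro A B hd h1 hu
    obtain ⟨u, huB, hu⟩ := hu
    by_cases hAB : A * B ≤ B
    · refine ⟨B / B, B, Submodule.one_mem_div.mpr le_rfl, ?_, le_rfl, ?_, ?_, ?_⟩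
      · rw [Submodule.le_div_iff_mul_le, mul_assoc]
        have : B / B * B ≤ B := Submodule.le_div_iff_mul_le.mp le_rfl
        exact (mul_le_mul' le_rfl this).trans this
      · intro b hb
        simpa using Submodule.mul_mem_mul h1 hb
      · exact Submodule.le_div_iff_mul_le.mp le_rfl
      · have := Submodule.finrank_mono (Submodule.le_div_iff_mul_le.mpr hAB)
        omega
    · have : ∃ b ∈ B, (∀ i, b i ≠ 0) ∧ ¬ A.map (LinearMap.mulLeft K b) ≤ B := by
        by_contra hc
        push Not at hc
        apply hAB
        rw [Submodule.mul_le]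
        intro a ha b hb
        obtain ⟨c, hcu⟩ := exists_unit_avoid hu b
        have e1 := hc _ (B.add_mem hb (B.smul_mem c huB)) hcu ⟨a, ha, rfl⟩
        have e2 := hc _ huB hu ⟨a, ha, rfl⟩
        have : a * b = (b + c • u) * a - c • (u * a) := by
          rw [add_mul, smul_mul_assoc]; simp [mul_comm]
        rw [this]
        exact B.sub_mem e1 (B.smul_mem c e2)
      obtain ⟨b, hb, hbu, hbA⟩ := this
      set A' := A ⊓ B.comap (LinearMap.mulLeft K b) with hA'
      set B' := B ⊔ A.map (LinearMap.mulLeft K b) with hB'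
      have hlt : A' < A := by
        refine lt_of_le_of_ne inf_le_left fun h => hbA ?_
        rw [Submodule.map_le_iff_le_comap]
        exact inf_eq_left.mp h
      have hlt' := Submodule.finrank_lt_finrank_of_lt hlt
      obtain ⟨H, U, hH1, hHH, hBU, hUA, hHU, hf⟩ := ih A' B' (by omega)
        ⟨h1, by simpa using hb⟩ ⟨u, Submodule.mem_sup_left huB, hu⟩
      refine ⟨H, U, hH1, hHH, le_sup_left.trans hBU, hUA.trans ?_, hHU, ?_⟩
      · rw [Submodule.mul_le]
        intro a ha x hx
        obtain ⟨y, hy, z, hz, rfl⟩ := Submodule.mem_sup.mp hx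
        obtain ⟨w, hw, rfl⟩ := hz
        rw [mul_add]
        refine Submodule.add_mem _ (Submodule.mul_mem_mul ha.1 hy) ?_
        have h3 : b * a ∈ B := ha.2
        have : a * (LinearMap.mulLeft K b) w = w * (b * a) := by
          simp only [LinearMap.mulLeft_apply]; ring
        rw [this]
        exact Submodule.mul_mem_mul hw h3
      · have e1 := Submodule.finrank_sup_add_finrank_inf_eq B (A.map (LinearMap.mulLeft K b))
        have e2 : B ⊓ A.map (LinearMap.mulLeft K b) = A'.map (LinearMap.mulLeft K b) := by
          ext x
          constructor
          · rintro ⟨hx, a, ha, rfl⟩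
            exact ⟨a, ⟨ha, hx⟩, rfl⟩
          · rintro ⟨a, ⟨ha, hx⟩, rfl⟩
            exact ⟨hx, a, ha, rfl⟩
        rw [e2, finrank_mapMul hbu, finrank_mapMul hbu, ← hB'] at e1
        omega

/-- A unital subalgebra is determined by the equivalence relation on the coordinates. -/
theorem mem_of_const (H : Submodule K (Fin n → K)) (h1 : 1 ∈ H) (hHH : H * H ≤ H)
    (x : Fin n → K) (hx : ∀ i j, (∀ h ∈ H, h i = h j) → x i = x j) : x ∈ H := by
  classical
  have hmul : ∀ a ∈ H, ∀ b ∈ H, a * b ∈ H := Submodule.mul_le.mp hHH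
  let s : Setoid (Fin n) :=
    { r := fun i j => ∀ h ∈ H, h i = h j
      iseqv := ⟨fun i h _ => rfl, fun q h hh => (q h hh).symm,
        fun q q' h hh => (q h hh).trans (q' h hh)⟩ }
  have hprod : ∀ (F : Finset (Fin n)) (f : Fin n → (Fin n → K)), (∀ j, f j ∈ H) →
      (∏ j ∈ F, f j) ∈ H := by
    intro F f hf
    induction F using Finset.induction_on with
    | empty => simpa using h1
    | insert a F ha ih => rw [Finset.prod_insert ha]; exact hmul _ (hf a) _ ih
  have hsep : ∀ i j, ∃ f ∈ H, f i = 1 ∧ (¬ (∀ h ∈ H, h i = h j) → f j = 0) := by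
    intro i j
    by_cases hij : ∀ h ∈ H, h i = h j
    · exact ⟨1, h1, rfl, fun h => absurd hij h⟩
    · push Not at hij
      obtain ⟨h, hh, hne⟩ := hij
      have hne' : h i - h j ≠ 0 := sub_ne_zero.mpr hne
      refine ⟨(h i - h j)⁻¹ • (h - h j • 1), H.smul_mem _ (H.sub_mem hh (H.smul_mem _ h1)), ?_, ?_⟩
      · simp [hne']
      · intro _; simp
  choose f hfH hf1 hf0 using hsep
  have key : x = ∑ q : Quotient s, x q.out • ∏ j, f q.out j := by
    funext k
    rw [Finset.sum_apply, Finset.sum_eq_single (Quotient.mk s k)]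
    · have hk : ∀ h ∈ H, h (Quotient.mk s k).out = h k := Quotient.mk_out (s := s) k
      have hp := hk _ (hprod Finset.univ (f (Quotient.mk s k).out) (hfH _))
      simp only [Pi.smul_apply, smul_eq_mul]
      rw [← hp, Finset.prod_apply, Finset.prod_eq_one (fun j _ => hf1 _ j), mul_one]
      exact (hx _ _ hk).symm
    · intro q _ hq
      have : ¬ ∀ h ∈ H, h q.out = h k := by
        intro h
        apply hq
        rw [← Quotient.out_eq q]
        exact Quotient.sound (s := s) h
      simp only [Pi.smul_apply, smul_eq_mul, Finset.prod_apply]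
      rw [Finset.prod_eq_zero (f := fun c => f q.out c k) (Finset.mem_univ k) (hf0 q.out k this), mul_zero]
    · intro h; exact absurd (Finset.mem_univ _) h
  rw [key]
  exact H.sum_mem fun q _ => H.smul_mem _ (hprod _ _ (hfH _))

theorem finite_subalg : Finite {H : Submodule K (Fin n → K) // 1 ∈ H ∧ H * H ≤ H} := by
  refine Finite.of_injective
    (β := Set (Fin n × Fin n)) (fun H => {q | ∀ h ∈ H.1, h q.1 = h q.2}) ?_
  have aux : ∀ H H' : {H : Submodule K (Fin n → K) // 1 ∈ H ∧ H * H ≤ H},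
      ({q : Fin n × Fin n | ∀ h ∈ H.1, h q.1 = h q.2}) = {q | ∀ h ∈ H'.1, h q.1 = h q.2} →
      H.1 ≤ H'.1 := by
    intro H H' h x hx
    refine mem_of_const H'.1 H'.2.1 H'.2.2 x fun i j hij => ?_
    have : (i, j) ∈ {q : Fin n × Fin n | ∀ h ∈ H.1, h q.1 = h q.2} := by
      rw [h]; exact hij
    exact this x hx
  intro H H' h
  exact Subtype.ext (le_antisymm (aux H H' h) (aux H' H h.symm))

theorem kneser_code [Infinite K] (A B : Submodule K (Fin n → K))
    (hA : ∃ u ∈ A, ∀ i, u i ≠ 0) (hB : ∃ u ∈ B, ∀ i, u i ≠ 0) :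
    ∃ H : Submodule K (Fin n → K), 1 ∈ H ∧ H * H ≤ H ∧ H * (A * B) ≤ A * B ∧
      Module.finrank K A + Module.finrank K B ≤
        Module.finrank K ↥(A * B) + Module.finrank K H := by
  classical
  rcases Nat.eq_zero_or_pos n with hn | hn
  · subst hn
    refine ⟨⊤, trivial, le_top, ?_, ?_⟩
    · intro x _; rw [Subsingleton.elim x 0]; exact Submodule.zero_mem _
    · simp [Module.finrank_zero_of_subsingleton]
  have hloc : ∀ a : {a : Fin n → K // a ∈ A ∧ ∀ i, a i ≠ 0},
      ∃ H : {H : Submodule K (Fin n → K) // 1 ∈ H ∧ H * H ≤ H}, ∃ U : Submodule K (Fin n → K),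
        B ≤ U ∧ U.map (LinearMap.mulLeft K a.1) ≤ A * B ∧ H.1 * U ≤ U ∧
        Module.finrank K A + Module.finrank K B ≤ Module.finrank K U + Module.finrank K H.1 := by
    rintro ⟨a, haA, ha⟩
    have hai : ∀ i, a⁻¹ i ≠ 0 := fun i => inv_ne_zero (ha i)
    have haa : a⁻¹ * a = 1 := by funext i; simp [ha i]
    obtain ⟨H, U, h1, h2, h3, h4, h5, h6⟩ := kneser_local _ (A.map (LinearMap.mulLeft K a⁻¹)) B le_rfl
      ⟨a, haA, haa⟩ hB
    rw [finrank_mapMul hai] at h6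
    refine ⟨⟨H, h1, h2⟩, U, h3, ?_, h5, h6⟩
    refine (Submodule.map_mono h4).trans ?_
    rw [Submodule.map_le_iff_le_comap, Submodule.mul_le]
    rintro _ ⟨x, hx, rfl⟩ b hb
    have : a * (a⁻¹ * x * b) = x * b := by
      rw [← mul_assoc, ← mul_assoc, mul_comm a, haa, one_mul]
    simp only [Submodule.mem_comap, LinearMap.mulLeft_apply]
    rw [this]
    exact Submodule.mul_mem_mul hx hb
  choose Hf Uf hBU hUA hHU hfr using hloc
  have := finite_subalg (K := K) (n := n)
  have hex : ∃ H : {H : Submodule K (Fin n → K) // 1 ∈ H ∧ H * H ≤ H},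
      A ≤ Submodule.span K {x | ∃ a, Hf a = H ∧ a.1 = x} := by
    by_contra hc
    push Not at hc
    obtain ⟨u, huA, hu⟩ := hA
    obtain ⟨a, haA, ha⟩ := exists_generic (ι := _ ⊕ Fin n) A
      (Sum.elim (fun H : {H : Submodule K (Fin n → K) // 1 ∈ H ∧ H * H ≤ H} =>
          Submodule.span K {x | ∃ a, Hf a = H ∧ a.1 = x})
        (fun i => LinearMap.ker (LinearMap.proj (R := K) (φ := fun _ : Fin n => K) i))) (by
        rintro (H | i)
        · exact hc H
        · intro h
          exact hu i (by simpa using h huA))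
    have ha' : ∀ i, a i ≠ 0 := fun i => by simpa using ha (Sum.inr i)
    exact ha (Sum.inl (Hf ⟨a, haA, ha'⟩)) (Submodule.subset_span ⟨_, rfl, rfl⟩)
  obtain ⟨H, hH⟩ := hex
  refine ⟨H.1, H.2.1, H.2.2, ?_, ?_⟩
  · rw [Submodule.mul_le]
    intro h hh x hx
    have : A * B ≤ (A * B).comap (LinearMap.mulLeft K h) := by
      rw [Submodule.mul_le]
      intro a ha b hb
      have hle : Submodule.span K {x | ∃ a, Hf a = H ∧ a.1 = x} ≤
          (A * B).comap (LinearMap.mulLeft K (h * b)) := by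
        rw [Submodule.span_le]
        rintro _ ⟨a', rfl, rfl⟩
        have : h * b * a'.1 = a'.1 * (h * b) := by ring
        simp only [SetLike.mem_coe, Submodule.mem_comap, LinearMap.mulLeft_apply]
        rw [this]
        exact hUA a' ⟨h * b, hHU a' (Submodule.mul_mem_mul hh (hBU a' hb)), rfl⟩
      have := hle (hH ha)
      simp only [Submodule.mem_comap, LinearMap.mulLeft_apply] at this ⊢
      have e : h * (a * b) = h * b * a := by ring
      rw [e]; exact this
    exact this hx
  · have hne : ∃ a, Hf a = H := by
      by_contra hc
      push Not at hc
      obtain ⟨u, huA, hu⟩ := hA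
      have : {x | ∃ a, Hf a = H ∧ a.1 = x} = ∅ := by
        ext x; simp only [Set.mem_ofPred_eq, Set.mem_empty_iff_false, iff_false]
        rintro ⟨a, h, _⟩; exact hc a h
      rw [this] at hH
      have h0 : u = 0 := by simpa using hH huA
      exact hu ⟨0, hn⟩ (by rw [h0]; rfl)
    obtain ⟨a, rfl⟩ := hne
    have e1 := Submodule.finrank_mono (hUA a)
    rw [finrank_mapMul a.2.2] at e1
    have := hfr a
    omega


theorem ind_apply (T : Set (Fin n)) (v : Fin n → K) : indicatorMapL T v = T.indicator v := rfl

theorem ind_one_mem {T : Set (Fin n)} {j : Fin n} (hj : j ∈ T) :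
    indicatorMapL T (1 : Fin n → K) j = 1 := by
  simp [ind_apply, hj]

theorem ind_one_notMem {T : Set (Fin n)} {j : Fin n} (hj : j ∉ T) :
    indicatorMapL T (1 : Fin n → K) j = 0 := by
  simp [ind_apply, hj]

theorem ind_mul (T : Set (Fin n)) (v w : Fin n → K) :
    indicatorMapL T (v * w) = indicatorMapL T v * w := by
  classical
  funext i
  simp only [ind_apply, Pi.mul_apply, Set.indicator_apply]
  split_ifs <;> simp

theorem finrank_split (T : Set (Fin n)) (X : Submodule K (Fin n → K))
    (hX : ∀ x ∈ X, indicatorMapL T x ∈ X) :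
    Module.finrank K X = Module.finrank K (X.map (indicatorMapL T)) +
      Module.finrank K (X.map (indicatorMapL Tᶜ)) := by
  classical
  have hsum : ∀ x : Fin n → K, indicatorMapL T x + indicatorMapL Tᶜ x = x := by
    intro x
    exact Set.indicator_self_add_compl T x
  have e : X = X.map (indicatorMapL T) ⊔ X.map (indicatorMapL Tᶜ) := by
    apply le_antisymm
    · intro x hx
      rw [← hsum x]
      exact Submodule.add_mem_sup ⟨x, hx, rfl⟩ ⟨x, hx, rfl⟩
    · rw [sup_le_iff]
      constructor
      · rintro _ ⟨x, hx, rfl⟩; exact hX x hx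
      · rintro _ ⟨x, hx, rfl⟩
        have : indicatorMapL Tᶜ x = x - indicatorMapL T x := eq_sub_of_add_eq' (hsum x)
        rw [this]; exact X.sub_mem hx (hX x hx)
  have e2 : X.map (indicatorMapL T) ⊓ X.map (indicatorMapL Tᶜ) = ⊥ := by
    rw [eq_bot_iff]
    rintro _ ⟨⟨x, hx, rfl⟩, ⟨y, hy, hxy⟩⟩
    rw [Submodule.mem_bot]
    funext i
    have := congrFun hxy i
    simp only [ind_apply, Set.indicator_apply] at this ⊢
    by_cases hi : i ∈ T
    · rw [if_neg (by simpa using hi)] at this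
      exact this.symm
    · rw [if_neg hi]; rfl
  have := Submodule.finrank_sup_add_finrank_inf_eq (X.map (indicatorMapL T))
    (X.map (indicatorMapL Tᶜ))
  rw [e2, ← e, finrank_bot] at this
  omega

theorem finrank_HV [Infinite K] (H V : Submodule K (Fin n → K)) (h1 : 1 ∈ H) (hHH : H * H ≤ H)
    (hV : ∃ u ∈ V, ∀ i, u i ≠ 0) (S : Set (Fin n))
    (hS : ∀ i ∈ S, ∃ j k, (∀ h ∈ H, h i = h j) ∧ (∀ h ∈ H, h i = h k) ∧
      ∃ v ∈ V, ∃ w ∈ V, v j * w k ≠ v k * w j) :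
    2 * Module.finrank K H + Module.finrank K (V.map (indicatorMapL S)) ≤
      2 * Module.finrank K ↥(H * V) := by
  classical
  obtain ⟨u, huV, hu⟩ := hV
  set T : Set (Fin n) := {i | ∃ j k, (∀ h ∈ H, h i = h j) ∧ (∀ h ∈ H, h i = h k) ∧
      ∃ v ∈ V, ∃ w ∈ V, v j * w k ≠ v k * w j} with hT
  have hST : S ⊆ T := fun i hi => hS i hi
  have hTsat : ∀ i j, (∀ h ∈ H, h i = h j) → i ∈ T → j ∈ T := by
    rintro i j hij ⟨a, b, ha, hb, hvw⟩
    exact ⟨a, b, fun h hh => (hij h hh).symm.trans (ha h hh),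
      fun h hh => (hij h hh).symm.trans (hb h hh), hvw⟩
  have he : (indicatorMapL T (1 : Fin n → K)) ∈ H := by
    refine mem_of_const H h1 hHH _ fun i j hij => ?_
    have : i ∈ T ↔ j ∈ T := ⟨hTsat i j hij, hTsat j i fun h hh => (hij h hh).symm⟩
    simp only [ind_apply, Set.indicator_apply, this, Pi.one_apply]
  have hmul : ∀ a ∈ H, ∀ b ∈ H, a * b ∈ H := Submodule.mul_le.mp hHH
  have heH : ∀ x ∈ H, indicatorMapL T x ∈ H := by
    intro x hx
    rw [← one_mul x, ind_mul]; exact hmul _ he _ hx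
  have heHV : ∀ x ∈ H * V, indicatorMapL T x ∈ H * V := by
    have : H * V ≤ (H * V).comap (indicatorMapL T) := by
      rw [Submodule.mul_le]
      intro h hh v hv
      rw [Submodule.mem_comap, ind_mul]
      exact Submodule.mul_mem_mul (heH h hh) hv
    exact fun x hx => this hx
  -- a generic element of `V`
  let N : T → Submodule K (Fin n → K) := fun i =>
    { carrier := {w | ∀ j k, (∀ h ∈ H, h i.1 = h j) → (∀ h ∈ H, h i.1 = h k) →
        w j * u k = w k * u j}
      add_mem' := by
        intro a b ha hb j k hj hk
        simp only [Pi.add_apply, add_mul]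
        rw [ha j k hj hk, hb j k hj hk]
      zero_mem' := by intro j k _ _; simp
      smul_mem' := by
        intro c a ha j k hj hk
        simp only [Pi.smul_apply, smul_eq_mul, mul_assoc]
        rw [ha j k hj hk] }
  obtain ⟨w, hwV, hw⟩ := exists_generic (ι := T ⊕ Fin n) V
    (Sum.elim N (fun i => LinearMap.ker (LinearMap.proj (R := K) (φ := fun _ : Fin n => K) i))) (by
      rintro (⟨i, hi⟩ | i)
      · intro hle
        obtain ⟨j, k, hj, hk, v, hv, w, hw, hne⟩ := hi
        have e1 : v j * u k = v k * u j := hle hv j k hj hk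
        have e2 : w j * u k = w k * u j := hle hw j k hj hk
        apply hne
        apply mul_right_cancel₀ (mul_ne_zero (hu j) (hu k))
        linear_combination w k * u j * e1 - v k * u j * e2
      · intro h
        exact hu i (by simpa using h huV))
  have hw0 : ∀ i, w i ≠ 0 := fun i => by simpa using hw (Sum.inr i)
  have hwN : ∀ i ∈ T, ∃ j k, (∀ h ∈ H, h i = h j) ∧ (∀ h ∈ H, h i = h k) ∧
      w j * u k ≠ w k * u j := by
    intro i hi
    by_contra hc
    push Not at hc
    exact hw (Sum.inl ⟨i, hi⟩) hc
  have s1 := finrank_split T H heH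
  have s2 := finrank_split T (H * V) heHV
  set P := H.map (indicatorMapL T) with hP
  have hPmul : ∀ v ∈ V, P.map (LinearMap.mulLeft K v) ≤ (H * V).map (indicatorMapL T) := by
    rintro v hv _ ⟨_, ⟨h, hh, rfl⟩, rfl⟩
    refine ⟨h * v, Submodule.mul_mem_mul hh hv, ?_⟩
    rw [ind_mul, LinearMap.mulLeft_apply, mul_comm]
  have b1 : Module.finrank K (H.map (indicatorMapL Tᶜ)) ≤
      Module.finrank K ((H * V).map (indicatorMapL Tᶜ)) := by
    rw [← finrank_mapMul hu]
    apply Submodule.finrank_mono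
    rintro _ ⟨_, ⟨h, hh, rfl⟩, rfl⟩
    refine ⟨h * u, Submodule.mul_mem_mul hh huV, ?_⟩
    rw [ind_mul, LinearMap.mulLeft_apply, mul_comm]
  have b2 : 2 * Module.finrank K P ≤ Module.finrank K ((H * V).map (indicatorMapL T)) := by
    have hle : P.map (LinearMap.mulLeft K u) ⊔ P.map (LinearMap.mulLeft K w) ≤
        (H * V).map (indicatorMapL T) := sup_le (hPmul u huV) (hPmul w hwV)
    have hinf : P.map (LinearMap.mulLeft K u) ⊓ P.map (LinearMap.mulLeft K w) = ⊥ := by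
      rw [eq_bot_iff]
      rintro _ ⟨⟨_, ⟨x, hx, rfl⟩, rfl⟩, ⟨_, ⟨y, hy, rfl⟩, hxy⟩⟩
      rw [Submodule.mem_bot]
      funext i
      by_cases hi : i ∈ T
      · obtain ⟨j, k, hj, hk, hne⟩ := hwN i hi
        have hjT := hTsat i j hj hi
        have hkT := hTsat i k hk hi
        have ej := congrFun hxy j
        have ek := congrFun hxy k
        simp only [ind_apply, LinearMap.mulLeft_apply, Pi.mul_apply, Set.indicator_apply, hjT, hkT,
          if_true, hi, Pi.zero_apply] at ej ek ⊢
        rw [← hj x hx, ← hj y hy] at ej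
        rw [← hk x hx, ← hk y hy] at ek
        have hy0 : y i = 0 := by
          by_contra hy0
          apply hne
          apply mul_left_cancel₀ hy0
          linear_combination u k * ej - u j * ek
        rw [hy0, mul_zero] at ej
        have : x i = 0 := by
          rcases mul_eq_zero.mp ej.symm with h | h
          · exact absurd h (hu j)
          · exact h
        rw [this, mul_zero]
      · simp [ind_apply, hi]
    have e1 := Submodule.finrank_sup_add_finrank_inf_eq (P.map (LinearMap.mulLeft K u))
      (P.map (LinearMap.mulLeft K w))
    rw [hinf, finrank_bot, finrank_mapMul hu, finrank_mapMul hw0] at e1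
    have e2 := Submodule.finrank_mono hle
    omega
  have b3 : Module.finrank K (V.map (indicatorMapL S)) ≤
      Module.finrank K ((H * V).map (indicatorMapL T)) := by
    have e1 : V.map (indicatorMapL S) ≤
        ((H * V).map (indicatorMapL T)).map (indicatorMapL S) := by
      rintro _ ⟨v, hv, rfl⟩
      refine ⟨indicatorMapL T v, ⟨v, by simpa using Submodule.mul_mem_mul h1 hv, rfl⟩, ?_⟩
      simp only [ind_apply]
      rw [Set.indicator_indicator, Set.inter_eq_left.mpr hST]
    exact (Submodule.finrank_mono e1).trans (Submodule.finrank_map_le _ _)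
  omega

theorem main_inf [Infinite K] (V : Submodule K (Fin n → K)) (hV : ∃ u ∈ V, ∀ i, u i ≠ 0)
    (k : ℕ) (S : Set (Fin n))
    (hS : ∀ i ∈ S, ∃ j l, (∀ h ∈ V ^ (k + 2) / V ^ (k + 2), h i = h j) ∧
      (∀ h ∈ V ^ (k + 2) / V ^ (k + 2), h i = h l) ∧
      ∃ v ∈ V, ∃ w ∈ V, v j * w l ≠ v l * w j) :
    2 * Module.finrank K ↥(V ^ (k + 1)) + Module.finrank K (V.map (indicatorMapL S)) ≤
      2 * Module.finrank K ↥(V ^ (k + 2)) := by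
  set E := V ^ (k + 2) with hE
  set H := E / E with hH
  have h1 : 1 ∈ H := Submodule.one_mem_div.mpr le_rfl
  have h1' : (1 : Submodule K (Fin n → K)) ≤ H := Submodule.one_le.mpr h1
  have hHE : H * E ≤ E := Submodule.le_div_iff_mul_le.mp le_rfl
  have hHH : H * H ≤ H := by
    rw [hH, Submodule.le_div_iff_mul_le, ← hH, mul_assoc]
    exact (mul_le_mul' le_rfl hHE).trans hHE
  have hle : ∀ X : Submodule K (Fin n → K), X ≤ H * X := fun X => by
    simpa using mul_le_mul' h1' (le_refl X)
  have a1 := finrank_HV H V h1 hHH hV S hS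
  obtain ⟨u, huV, hu⟩ := hV
  obtain ⟨H', g1, g2, g3, g4⟩ := kneser_code (H * V) (H * V ^ (k + 1))
    ⟨u, hle _ huV, hu⟩ ⟨u ^ (k + 1), hle _ (Submodule.pow_mem_pow _ huV _),
      fun i => by simpa using hu i⟩
  have hprod : (H * V) * (H * V ^ (k + 1)) = E := by
    apply le_antisymm
    · calc (H * V) * (H * V ^ (k + 1)) = (H * H) * E := by rw [hE]; ring
        _ ≤ H * E := mul_le_mul' hHH le_rfl
        _ ≤ E := hHE
    · calc E = V * V ^ (k + 1) := by rw [hE]; ring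
        _ ≤ _ := mul_le_mul' (hle _) (hle _)
  rw [hprod] at g3 g4
  have a2 := Submodule.finrank_mono (Submodule.le_div_iff_mul_le.mpr g3)
  have a3 := Submodule.finrank_mono (hle (V ^ (k + 1)))
  rw [← hH] at a2
  omega

end kneserAux

section baseChangeAux

variable {F K : Type*} [Field F] [Field K] [Algebra F K] {n : ℕ}

/-- coordinatewise extension of scalars -/
def extV (F K : Type*) [Field F] [Field K] [Algebra F K] {n : ℕ} (v : Fin n → F) : Fin n → K :=
  fun i => algebraMap F K (v i)

/-- extension of scalars of a code -/
def extS (K : Type*) [Field K] [Algebra F K] (E : Submodule F (Fin n → F)) :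
    Submodule K (Fin n → K) :=
  Submodule.span K (extV F K '' (E : Set (Fin n → F)))

theorem extV_mul (v w : Fin n → F) : extV F K (v * w) = extV F K v * extV F K w := by
  funext i; simp [extV]

theorem extV_add (v w : Fin n → F) : extV F K (v + w) = extV F K v + extV F K w := by
  funext i; simp [extV]

theorem extV_smul (c : F) (w : Fin n → F) : extV F K (c • w) = algebraMap F K c • extV F K w := by
  funext i; simp [extV]

theorem extV_zero : extV F K (0 : Fin n → F) = 0 := by
  funext i; simp [extV]

theorem extV_mem {E : Submodule F (Fin n → F)} {v : Fin n → F} (h : v ∈ E) : extV F K v ∈ extS K E :=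
  Submodule.subset_span ⟨v, h, rfl⟩

theorem extS_mul (C D : Submodule F (Fin n → F)) : extS K (C * D) = extS K C * extS K D := by
  apply le_antisymm
  · rw [extS, Submodule.span_le]
    rintro _ ⟨x, hx, rfl⟩
    refine Submodule.mul_induction_on hx ?_ ?_
    · intro c hc d hd
      rw [extV_mul]
      exact Submodule.mul_mem_mul (extV_mem hc) (extV_mem hd)
    · intro x y hx hy
      rw [extV_add]; exact Submodule.add_mem _ hx hy
  · unfold extS
    rw [Submodule.span_mul_span, Submodule.span_le]
    rintro _ ⟨_, ⟨c, hc, rfl⟩, _, ⟨d, hd, rfl⟩, rfl⟩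
    simp only
    rw [← extV_mul]
    exact extV_mem (Submodule.mul_mem_mul hc hd)

theorem extS_pow (C : Submodule F (Fin n → F)) (k : ℕ) :
    extS K (C ^ (k + 1)) = extS K C ^ (k + 1) := by
  induction k with
  | zero => simp
  | succ k ih => rw [pow_succ C, extS_mul, ih, ← pow_succ]

theorem extS_finrank (E : Submodule F (Fin n → F)) :
    Module.finrank K (extS K E) = Module.finrank F E := by
  let b := Module.finBasis F E
  have hli : LinearIndependent F (fun i => (b i : Fin n → F)) :=
    b.linearIndependent.map' E.subtype (Submodule.ker_subtype E)
  have hli' : LinearIndependent K (fun i => extV F K (b i : Fin n → F)) :=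
    (linearIndependent_algebraMap_comp_iff (R := F) (S := K)).mpr hli
  have hspan : extS K E = Submodule.span K (Set.range fun i => extV F K (b i : Fin n → F)) := by
    apply le_antisymm
    · rw [extS, Submodule.span_le]
      rintro _ ⟨x, hx, rfl⟩
      have : x = ∑ i, b.repr ⟨x, hx⟩ i • (b i : Fin n → F) := by
        have := congrArg E.subtype (b.sum_repr ⟨x, hx⟩)
        rw [map_sum] at this
        exact this.symm
      have hx2 : extV F K x = ∑ i, algebraMap F K (b.repr ⟨x, hx⟩ i) • extV F K (b i : Fin n → F) := by
        conv_lhs => rw [this]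
        funext j
        simp [extV, Finset.sum_apply, map_sum, -Module.Basis.repr_self]
        simp [Algebra.smul_def]
      rw [hx2]
      exact Submodule.sum_mem _ fun i _ => Submodule.smul_mem _ _ (Submodule.subset_span ⟨i, rfl⟩)
    · rw [Submodule.span_le]
      rintro _ ⟨i, rfl⟩
      exact extV_mem (b i).2
  rw [hspan, finrank_span_eq_card hli']
  simp

theorem mem_of_extV_mem {E : Submodule F (Fin n → F)} {x : Fin n → F} (h : extV F K x ∈ extS K E) :
    x ∈ E := by
  obtain ⟨g, hg⟩ := LinearMap.exists_leftInverse_of_injective (Algebra.linearMap F K)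
    (LinearMap.ker_eq_bot.mpr (algebraMap F K).injective)
  have hg' : ∀ c : F, g (algebraMap F K c) = c := fun c => LinearMap.congr_fun hg c
  have key : ∀ y ∈ extS K E, ∀ c : K, (fun i => g (c * y i)) ∈ E := by
    intro y hy
    refine Submodule.span_induction ?_ ?_ ?_ ?_ hy
    · rintro _ ⟨z, hz, rfl⟩ c
      have : (fun i => g (c * extV F K z i)) = g c • z := by
        funext i
        simp only [extV, Pi.smul_apply, smul_eq_mul]
        rw [mul_comm c, ← Algebra.smul_def, map_smul, smul_eq_mul, mul_comm]
      rw [this]; exact E.smul_mem _ hz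
    · intro c
      have : (fun i => g (c * (0 : Fin n → K) i)) = 0 := by funext i; simp
      rw [this]; exact E.zero_mem
    · intro a b _ _ ha hb c
      have := E.add_mem (ha c) (hb c)
      convert this using 1
      funext i
      simp [mul_add]
    · intro a b _ hb c
      have := hb (c * a)
      simpa [mul_assoc] using this
  have := key _ h 1
  simpa [extV, hg'] using this

theorem extS_ind (S : Set (Fin n)) (E : Submodule F (Fin n → F)) :
    extS K (E.map (indicatorMapL S)) = (extS K E).map (indicatorMapL S) := by
  classical
  unfold extS
  rw [Submodule.map_span, Submodule.map_coe, Set.image_image, Set.image_image]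
  congr 1
  apply Set.image_congr
  intro v _
  funext i
  simp only [ind_apply, extV, Set.indicator_apply]
  split_ifs <;> simp

theorem schurMul_eq (C D : Submodule F (Fin n → F)) : schurMul C D = C * D := by
  apply le_antisymm
  · rw [schurMul, Submodule.span_le]
    rintro _ ⟨c, hc, d, hd, rfl⟩
    exact Submodule.mul_mem_mul hc hd
  · rw [Submodule.mul_le]
    intro c hc d hd
    exact Submodule.subset_span ⟨c, hc, d, hd, rfl⟩

theorem schurPow_eq (C : Submodule F (Fin n → F)) (k : ℕ) : schurPow C k = C ^ (k + 1) := by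
  induction k with
  | zero => simp [schurPow]
  | succ k ih => rw [schurPow, schurMul_eq, ih, ← pow_succ]

/-- `V` has rank at most one on the coordinates `T`, hence so do its powers. -/
theorem rankone_pow (V : Submodule F (Fin n → F)) (j l : Fin n)
    (h : ∀ v ∈ V, ∀ w ∈ V, v j * w l = v l * w j) (k : ℕ) :
    ∀ x ∈ V ^ (k + 1), ∀ y ∈ V ^ (k + 1), x j * y l = x l * y j := by
  induction k with
  | zero => simpa using h
  | succ k ih =>
    intro x hx y hy
    rw [pow_succ] at hx hy
    refine Submodule.mul_induction_on hx ?_ ?_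
    · intro a ha b hb
      refine Submodule.mul_induction_on hy ?_ ?_
      · intro c hc d hd
        have e1 := ih a ha c hc
        have e2 := h b hb d hd
        simp only [Pi.mul_apply]
        linear_combination b j * d l * e1 + a l * c j * e2
      · intro c d hc hd
        simp only [Pi.add_apply, mul_add, hc, hd]
    · intro c d hc hd
      simp only [Pi.add_apply, add_mul, hc, hd]

theorem supp_pow (V : Submodule F (Fin n → F)) (j : Fin n)
    (h : ∀ v ∈ V, v j = 0) (k : ℕ) : ∀ x ∈ V ^ (k + 1), x j = 0 := by
  intro x hx
  rw [pow_succ] at hx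
  refine Submodule.mul_induction_on hx ?_ ?_
  · intro a _ b hb; simp [h b hb]
  · intro a b ha hb; simp [ha, hb]

end baseChangeAux
/-- with the stabiliser decomposition `V^⟨t⟩ = C₁ ⊕ ⋯ ⊕ C_m`,
`I = {i : dim Cᵢ ≥ 2}`, `S = ⋃_{i ∈ I} supp(Cᵢ)` and `W = V|_S`, one has
`dim V^⟨r⟩ ≥ dim V^⟨r−1⟩ + ½ dim W` for all `2 ≤ r ≤ t`.
(Recall `schurPow V (r-1) = V^⟨r⟩`.) -/
theorem statement19 (p n t : ℕ) [Fact p.Prime] (ht : 0 < t)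
    (V : Submodule (ZMod p) (Fin n → ZMod p))
    (m : ℕ) (hm : m = Module.finrank (ZMod p) ↥(stab (schurPow V (t - 1))))
    (C : Fin m → Submodule (ZMod p) (Fin n → ZMod p))
    (hdec : schurPow V (t - 1) = ⨆ i, C i)
    (hne : ∀ i, (suppS (C i)).Nonempty)
    (hdisj : ∀ i j, i ≠ j → Disjoint (suppS (C i)) (suppS (C j)))
    (S : Set (Fin n))
    (hS : S = ⋃ i ∈ {i : Fin m | 2 ≤ Module.finrank (ZMod p) ↥(C i)}, suppS (C i))
    (r : ℕ) (hr2 : 2 ≤ r) (hrt : r ≤ t) :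
    2 * Module.finrank (ZMod p) ↥(schurPow V (r - 2)) +
        Module.finrank (ZMod p) ↥(restrTo S V) ≤
      2 * Module.finrank (ZMod p) ↥(schurPow V (r - 1)) := by
  classical
  obtain ⟨s, rfl⟩ : ∃ s, t = s + 1 := ⟨t - 1, by omega⟩
  obtain ⟨k, rfl⟩ : ∃ k, r = k + 2 := ⟨r - 2, by omega⟩
  rw [Nat.add_sub_cancel, schurPow_eq] at hm hdec
  rw [show k + 2 - 2 = k from rfl, show k + 2 - 1 = k + 1 from rfl, schurPow_eq, schurPow_eq]
  set E := V ^ (s + 1) with hE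
  let K := AlgebraicClosure (ZMod p)
  have : Infinite K := inferInstance
  have hCE : ∀ a, C a ≤ E := fun a => hdec ▸ le_iSup C a
  -- the stabiliser is spanned by the indicators of the supports
  let χ : Fin m → (Fin n → ZMod p) := fun a => indicatorMapL (suppS (C a)) 1
  have hχmem : ∀ a, χ a ∈ stab E := by
    intro a e he
    rw [hdec] at he
    refine Submodule.iSup_induction C (motive := fun e => χ a * e ∈ E) he ?_ ?_ ?_
    · intro j x hx
      have : χ a * x = if j = a then x else 0 := by
        split_ifs with hja
        · subst hja
          funext i
          by_cases hi : i ∈ suppS (C j)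
          · simp [χ, ind_apply, hi]
          · have : x i = 0 := by
              by_contra h; exact hi ⟨x, hx, h⟩
            simp [this]
        · funext i
          by_cases hi : i ∈ suppS (C a)
          · have : x i = 0 := by
              by_contra h
              exact Set.disjoint_left.mp (hdisj j a hja) ⟨x, hx, h⟩ hi
            simp [this]
          · simp [χ, ind_apply, hi]
      rw [this]
      split_ifs
      · exact hCE j hx
      · exact E.zero_mem
    · simp
    · intro x y hx hy
      rw [mul_add]; exact E.add_mem hx hy
  have hχval : ∀ a b i, i ∈ suppS (C a) → χ b i = if b = a then 1 else 0 := by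
    intro a b i hi
    split_ifs with hba
    · subst hba; simp [χ, ind_apply, hi]
    · have : i ∉ suppS (C b) := fun h => Set.disjoint_left.mp (hdisj b a hba) h hi
      simp [χ, ind_apply, this]
  have hχli : LinearIndependent (ZMod p) χ := by
    rw [Fintype.linearIndependent_iff]
    intro g hg a
    obtain ⟨i, hi⟩ := hne a
    have := congrFun hg i
    simpa [Finset.sum_apply, hχval a _ i hi] using this
  have hspan : Submodule.span (ZMod p) (Set.range χ) = stab E := by
    apply Submodule.eq_of_le_of_finrank_eq
    · rw [Submodule.span_le]
      rintro _ ⟨a, rfl⟩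
      exact hχmem a
    · rw [finrank_span_eq_card hχli, ← hm]; simp
  have hconst : ∀ x ∈ stab E, ∀ a, ∀ i ∈ suppS (C a), ∀ j ∈ suppS (C a), x i = x j := by
    intro x hx a i hi j hj
    rw [← hspan] at hx
    refine Submodule.span_induction ?_ ?_ ?_ ?_ hx
    · rintro _ ⟨b, rfl⟩
      rw [hχval a b i hi, hχval a b j hj]
    · rfl
    · intro x y _ _ h1 h2; simp [h1, h2]
    · intro c x _ h; simp [h]
  have hcover : ∀ i, ∃ a, i ∈ suppS (C a) := by
    intro i
    by_contra hc
    push Not at hc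
    have h0 : ∀ x ∈ stab E, x i = 0 := by
      intro x hx
      rw [← hspan] at hx
      refine Submodule.span_induction ?_ ?_ ?_ ?_ hx
      · rintro _ ⟨b, rfl⟩
        simp [χ, ind_apply, hc b]
      · rfl
      · intro x y _ _ h1 h2; simp [h1, h2]
      · intro c x _ h; simp [h]
    have h1 : (1 : Fin n → ZMod p) ∈ stab E := fun e he => by simpa using he
    exact one_ne_zero (h0 1 h1)
  have hfull : ∀ i, ∃ v ∈ V, v i ≠ 0 := by
    intro i
    by_contra hc
    push Not at hc
    obtain ⟨a, x, hx, hxi⟩ := hcover i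
    exact hxi (supp_pow V i hc s x (hCE a hx))
  have hunit : ∃ u ∈ extS K V, ∀ i, u i ≠ 0 := by
    obtain ⟨u, hu, hu'⟩ := exists_generic (extS K V)
      (fun i => LinearMap.ker (LinearMap.proj (R := K) (φ := fun _ : Fin n => K) i)) (by
        intro i hle
        obtain ⟨v, hv, hvi⟩ := hfull i
        have h0 : extV (ZMod p) K v i = 0 := hle (extV_mem hv)
        exact hvi ((map_eq_zero (algebraMap (ZMod p) K)).mp h0))
    exact ⟨u, hu, fun i h => hu' i h⟩
  have hmain := main_inf (extS K V) hunit k S (by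
    intro i hi
    by_contra hc
    push Not at hc
    set H := extS K V ^ (k + 2) / extS K V ^ (k + 2) with hH
    have h1 : 1 ∈ H := Submodule.one_mem_div.mpr le_rfl
    have hHE : H * extS K V ^ (k + 2) ≤ extS K V ^ (k + 2) :=
      Submodule.le_div_iff_mul_le.mp le_rfl
    have hHH : H * H ≤ H := by
      rw [hH, Submodule.le_div_iff_mul_le, ← hH, mul_assoc]
      exact (mul_le_mul' le_rfl hHE).trans hHE
    set T : Set (Fin n) := {j | ∀ h ∈ H, h i = h j} with hT
    have hiT : i ∈ T := fun h _ => rfl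
    have hTH : indicatorMapL T (1 : Fin n → K) ∈ H := by
      refine mem_of_const H h1 hHH _ fun a b hab => ?_
      have : a ∈ T ↔ b ∈ T :=
        ⟨fun q h hh => (q h hh).trans (hab h hh), fun q h hh => (q h hh).trans (hab h hh).symm⟩
      simp only [ind_apply, Set.indicator_apply, this, Pi.one_apply]
    have hHEt : H * extS K E ≤ extS K E := by
      obtain ⟨d, rfl⟩ : ∃ d, s = k + 1 + d := ⟨s - (k + 1), by omega⟩
      rw [hE, extS_pow, show k + 1 + d + 1 = (k + 2) + d by ring, pow_add, ← mul_assoc]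
      exact mul_le_mul' hHE le_rfl
    have hTstab : indicatorMapL T (1 : Fin n → ZMod p) ∈ stab E := by
      intro e he
      apply mem_of_extV_mem (K := K)
      have e1 : extV (ZMod p) K (indicatorMapL T 1 * e) =
          indicatorMapL T (1 : Fin n → K) * extV (ZMod p) K e := by
        funext j
        rw [Pi.mul_apply]
        unfold extV
        rw [Pi.mul_apply, map_mul]
        by_cases hj : j ∈ T
        · rw [ind_one_mem hj, ind_one_mem hj, map_one]
        · rw [ind_one_notMem hj, ind_one_notMem hj, map_zero]
      rw [e1]
      exact hHEt (Submodule.mul_mem_mul hTH (extV_mem he))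
    rw [hS] at hi
    simp only [Set.mem_iUnion] at hi
    obtain ⟨a, ha2, hia⟩ := hi
    have ha2' : 2 ≤ Module.finrank (ZMod p) (C a) := ha2
    have hsub : suppS (C a) ⊆ T := by
      intro j hj
      have := hconst _ hTstab a i hia j hj
      by_contra hjT
      simp [ind_apply, hiT, hjT] at this
    have hVrank : ∀ j ∈ T, ∀ v ∈ V, ∀ w ∈ V, v i * w j = v j * w i := by
      intro j hj v hv w hw
      have := hc i j hiT hj _ (extV_mem hv) _ (extV_mem hw)
      simp only [extV, ← map_mul] at this
      exact (algebraMap (ZMod p) K).injective this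
    obtain ⟨c, hcC, hci⟩ := hia
    have hle : Module.finrank (ZMod p) (C a) ≤ 1 := by
      refine finrank_le_one (⟨c, hcC⟩ : C a) ?_
      rintro ⟨x, hx⟩
      refine ⟨x i / c i, Subtype.ext ?_⟩
      funext j
      simp only [SetLike.mk_smul_mk, Pi.smul_apply, smul_eq_mul]
      by_cases hj : j ∈ T
      · have := rankone_pow V i j (hVrank j hj) s x (hCE a hx) c (hCE a hcC)
        field_simp
        linear_combination this
      · have h0 : ∀ y ∈ C a, y j = 0 := by
          intro y hy
          by_contra h
          exact hj (hsub ⟨y, hy, h⟩)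
        rw [h0 x hx, h0 c hcC, mul_zero]
    omega)
  rw [← extS_pow, show k + 2 = (k + 1) + 1 from rfl, ← extS_pow, ← extS_ind,
    extS_finrank, extS_finrank, extS_finrank] at hmain
  exact hmain
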